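/- Let G be a vertex-minimal triangle-free, fork-free graph with chromatic number at least 4. Let C be a 5-cycle in G, and let u1, u2 be distinct vertices at distance exactly 2 from C with u1 adjacent to u2. Then there is no vertex v on C that is at distance exactly 2 from both u1 and u2. -/

import Mathlib

open SimpleGraph

/-- The fork: `K_{1,4}` with two edges subdivided. Vertex 0 is the center,
adjacent to leaves 1, 2 and to 3, 5; paths 0-3-4 and 0-5-6. -/
def fork : SimpleGraph (Fin 7) :=
  SimpleGraph.fromEdgeSet {s(0, 1), s(0, 2), s(0, 3), s(0, 5), s(3, 4), s(5, 6)}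

/-- A graph is fork-free if it has no induced subgraph isomorphic to the fork. -/
def ForkFree {V : Type} (G : SimpleGraph V) : Prop :=
  IsEmpty (fork ↪g G)

/-- `G` is a vertex-minimal triangle-free, fork-free graph with chromatic
number at least 4: every smaller triangle-free fork-free graph is 3-colorable. -/
def MinCex {V : Type} [Fintype V] (G : SimpleGraph V) : Prop :=
  G.CliqueFree 3 ∧ ForkFree G ∧ 4 ≤ G.chromaticNumber ∧
    ∀ (W : Type) [Fintype W] (H : SimpleGraph W),
      Fintype.card W < Fintype.card V → H.CliqueFree 3 → ForkFree H →
        H.chromaticNumber ≤ 3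

/-- `c` describes a 5-cycle in `G`. -/
def IsC5 {V : Type} (G : SimpleGraph V) (c : Fin 5 → V) : Prop :=
  Function.Injective c ∧ ∀ i : Fin 5, G.Adj (c i) (c (i + 1))

/-- Distance from a vertex `u` to the 5-cycle `c`. -/
noncomputable def distC {V : Type} (G : SimpleGraph V) (c : Fin 5 → V) (u : V) : ℕ :=
  Finset.univ.inf' Finset.univ_nonempty fun i => G.dist u (c i)

namespace ForkProof

/-! ### A small verified checker

Vertices are kept in a list `vs` (newest first).  The *type* of a vertex `w` is the list of
adjacency bits of `w` to `vs`; `rows vs` records the graph induced on `vs`. -/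

/-- Little-endian bits. -/
def bits : ℕ → ℕ → List Bool
  | 0, _ => []
  | n + 1, m => Nat.beq (m % 2) 1 :: bits n (m / 2)

/-- Boolean equality of bit lists. -/
def eqb : List Bool → List Bool → Bool
  | [], [] => true
  | true :: l, true :: m => eqb l m
  | false :: l, false :: m => eqb l m
  | _, _ => false

theorem eqb_eq : ∀ l m : List Bool, eqb l m = true ↔ l = m := by
  intro l
  induction l with
  | nil => intro m; cases m <;> simp [eqb]
  | cons a l ih =>
    intro m
    cases m with
    | nil => cases a <;> simp [eqb]
    | cons b m => cases a <;> cases b <;> simp [eqb, ih]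

/-- Adjacency lookup by position. -/
def adjL : List (List Bool) → ℕ → ℕ → Bool
  | [], _, _ => false
  | _ :: _, 0, 0 => false
  | r :: _, 0, j + 1 => r.getD j false
  | r :: _, i + 1, 0 => r.getD i false
  | _ :: g, i + 1, j + 1 => adjL g i j

/-- Do two rows have a common neighbour? -/
def common : List Bool → List Bool → Bool
  | true :: _, true :: _ => true
  | _ :: l, _ :: m => common l m
  | _, _ => false

/-- Seven positions inducing a fork. -/
def isFork (g : List (List Bool)) : List ℕ → Bool
  | [a, b, c, d, e, f, h] =>
    adjL g a b && adjL g a c && adjL g a d && adjL g a f && adjL g d e && adjL g f h &&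
    !adjL g a e && !adjL g a h && !adjL g b c && !adjL g b d && !adjL g b e && !adjL g b f &&
    !adjL g b h && !adjL g c d && !adjL g c e && !adjL g c f && !adjL g c h && !adjL g d f &&
    !adjL g d h && !adjL g e f && !adjL g e h && !Nat.beq b c &&
    [a, b, c, d, e, f, h].all (fun i => Nat.ble (i + 1) g.length)
  | _ => false

/-- Types of outside vertices after a vertex with row `R` was added. -/
def ext (g : List (List Bool)) (R : List Bool) (F : List (List ℕ)) (T : List (List Bool)) :
    List (List Bool) :=
  (T.flatMap fun A => if common A R then [false :: A] else [false :: A, true :: A]).filter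
    fun C => !F.any (fun l => isFork (C :: R :: g) l)

/-- Does the row `R` meet colour `k`? -/
def hit (k : ℕ) : List Bool → List (Option ℕ) → Bool
  | [], _ => false
  | _ :: _, [] => false
  | b :: R, p :: c =>
    match b with
    | false => hit k R c
    | true =>
      match p with
      | none => hit k R c
      | some m => Nat.beq m k || hit k R c

/-- Does giving the option `p` to a vertex with row `R` create a conflict? -/
def hitO (R : List Bool) (c : List (Option ℕ)) : Option ℕ → Bool
  | none => false
  | some k => hit k R c

/-- All proper partial colourings whose values are taken from the given lists of options. -/
def gen : List (List Bool) → List (List (Option ℕ)) → List (List (Option ℕ))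
  | [], _ => [[]]
  | _ :: _, [] => []
  | R :: g, a :: L => (gen g L).flatMap fun c =>
      (a.filter (fun p => !hitO R c p)).map (fun p => p :: c)

/-- Options off `S`; positions `p` and `q` get colours `0` and `1`. -/
def opts (p q : ℕ) : ℕ → List Bool → List (List (Option ℕ))
  | _, [] => []
  | i, true :: S => [none] :: opts p q (i + 1) S
  | i, false :: S =>
    (if Nat.beq i p then [some 0] else if Nat.beq i q then [some 1] else
      [some 0, some 1, some 2]) :: opts p q (i + 1) S

/-- Pointwise or. -/
def orL : List Bool → List Bool → List Bool
  | _, [] => []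
  | [], z => z
  | a :: A, b :: z => (a || b) :: orL A z

/-- Positions blocked for colour `k`: they have an outside neighbour that might have colour `k`. -/
def blocked (k : ℕ) (ψ : List (Option ℕ)) : List (List Bool) → List Bool
  | [] => ψ.map fun _ => false
  | A :: T => if hit k A ψ then blocked k ψ T else orL A (blocked k ψ T)

/-- Options for the positions left uncoloured by `ψ`. -/
def allow : List (Option ℕ) → List Bool → List Bool → List Bool → List (List (Option ℕ))
  | [], _, _, _ => []
  | some k :: ψ, b0, b1, b2 => [some k] :: allow ψ b0.tail b1.tail b2.tail
  | none :: ψ, b0, b1, b2 =>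
    ((if b0.headD true then [] else [some 0]) ++ ((if b1.headD true then [] else [some 1]) ++
      (if b2.headD true then [] else [some 2]))) :: allow ψ b0.tail b1.tail b2.tail

/-- Forces a bit list before continuing (identity semantically, helps kernel evaluation). -/
def forceB : List Bool → (List Bool → Bool) → Bool
  | [], k => k []
  | true :: l, k => forceB l fun m => k (true :: m)
  | false :: l, k => forceB l fun m => k (false :: m)

/-- Forces a list of bit lists. -/
def forceT : List (List Bool) → (List (List Bool) → Bool) → Bool
  | [], k => k []
  | A :: T, k => forceB A fun A' => forceT T fun T' => k (A' :: T')

/-- Forces a partial colouring. -/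
def forceC : List (Option ℕ) → (List (Option ℕ) → Bool) → Bool
  | [], k => k []
  | none :: l, k => forceC l fun m => k (none :: m)
  | some 0 :: l, k => forceC l fun m => k (some 0 :: m)
  | some 1 :: l, k => forceC l fun m => k (some 1 :: m)
  | some 2 :: l, k => forceC l fun m => k (some 2 :: m)
  | some (n + 3) :: l, k => forceC l fun m => k (some (n + 3) :: m)

theorem forceB_eq : ∀ (l : List Bool) (k : List Bool → Bool), forceB l k = k l
  | [], _ => rfl
  | true :: l, k => by rw [forceB, forceB_eq l]
  | false :: l, k => by rw [forceB, forceB_eq l]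

theorem forceT_eq : ∀ (l : List (List Bool)) (k : List (List Bool) → Bool), forceT l k = k l
  | [], _ => rfl
  | A :: l, k => by rw [forceT, forceB_eq, forceT_eq l]

theorem forceC_eq : ∀ (l : List (Option ℕ)) (k : List (Option ℕ) → Bool), forceC l k = k l
  | [], _ => rfl
  | none :: l, k => by rw [forceC, forceC_eq l]
  | some 0 :: l, k => by rw [forceC, forceC_eq l]
  | some 1 :: l, k => by rw [forceC, forceC_eq l]
  | some 2 :: l, k => by rw [forceC, forceC_eq l]
  | some (n + 3) :: l, k => by rw [forceC, forceC_eq l]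

/-- Every colouring off `S` extends. -/
def leafCheck (S : List Bool) (p q : ℕ) (g T : List (List Bool)) : Bool :=
  S.any (fun b => b) && adjL g p q && !S.getD p true && !S.getD q true &&
  (gen g (opts p q 0 S)).all fun ψ' => forceC ψ' fun ψ =>
    forceB (blocked 0 ψ T) fun b0 => forceB (blocked 1 ψ T) fun b1 =>
    forceB (blocked 2 ψ T) fun b2 => !(gen g (allow ψ b0 b1 b2)).isEmpty

/-- Certificates. -/
inductive Cert where
  | leaf (S p q : ℕ) : Cert
  | split (A : ℕ) (F : List (List ℕ)) (c₁ c₂ : Cert) : Cert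

/-- The checker. -/
def check : Cert → List (List Bool) → List (List Bool) → Bool
  | .leaf S p q, g, T => forceB (bits g.length S) fun S' => leafCheck S' p q g T
  | .split A F c₁ c₂, g, T =>
    forceB (bits g.length A) fun R =>
      (forceT (ext g R F T) fun T' => check c₁ (R :: g) T') &&
      (forceT (T.filter (fun B => !eqb B R)) fun T' => check c₂ g T')

/-- Builds the base configuration, then checks the certificate. -/
def buildCheck (c : Cert) : List (ℕ × List (List ℕ)) → List (List Bool) → List (List Bool) → Bool
  | [], g, T => check c g T
  | (A, F) :: l, g, T =>
    forceB (bits g.length A) fun R =>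
      forceT (ext g R F T) fun T' => buildCheck c l (R :: g) T'


/-! ### Soundness -/

section Sound

variable {V : Type}

open Classical in
/-- The type of `w` relative to `vs`. -/
noncomputable def tp (G : SimpleGraph V) (w : V) (vs : List V) : List Bool :=
  vs.map fun v => decide (G.Adj w v)

/-- The lower rows of the adjacency matrix of `vs`. -/
noncomputable def rows (G : SimpleGraph V) : List V → List (List Bool)
  | [] => []
  | v :: vs => tp G v vs :: rows G vs

theorem rows_length (G : SimpleGraph V) (vs : List V) : (rows G vs).length = vs.length := by
  induction vs with
  | nil => rfl
  | cons v vs ih => simp [rows, ih]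

theorem tp_getD (G : SimpleGraph V) (w : V) (vs : List V) (i : ℕ) (h : i < vs.length) :
    (tp G w vs).getD i false = true ↔ G.Adj w vs[i] := by
  simp [tp, List.getD, h]

theorem adjL_iff (G : SimpleGraph V) : ∀ (vs : List V) (i j : ℕ) (hi : i < vs.length)
    (hj : j < vs.length), adjL (rows G vs) i j = true ↔ G.Adj vs[i] vs[j]
  | [], _, _, hi, _ => by simp at hi
  | v :: vs, 0, 0, _, _ => by simp [adjL, rows]
  | v :: vs, 0, j + 1, _, hj => by
    have hj' : j < vs.length := by simpa using hj
    simpa [adjL, rows] using tp_getD G v vs j hj'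
  | v :: vs, i + 1, 0, hi, _ => by
    have hi' : i < vs.length := by simpa using hi
    rw [G.adj_comm]
    simpa [adjL, rows] using tp_getD G v vs i hi'
  | v :: vs, i + 1, j + 1, hi, hj => by
    have hi' : i < vs.length := by simpa using hi
    have hj' : j < vs.length := by simpa using hj
    simpa [adjL, rows] using adjL_iff G vs i j hi' hj'

theorem adjL_lt (G : SimpleGraph V) : ∀ (vs : List V) (i j : ℕ), adjL (rows G vs) i j = true →
    i < vs.length ∧ j < vs.length
  | [], _, _, h => by simp [adjL, rows] at h
  | v :: vs, 0, 0, h => by simp [adjL, rows] at h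
  | v :: vs, 0, j + 1, h => by
    refine ⟨by simp, ?_⟩
    by_contra hc
    have : ¬ j < vs.length := by simpa using hc
    simp [adjL, rows, tp, List.getD, this] at h
  | v :: vs, i + 1, 0, h => by
    refine ⟨?_, by simp⟩
    by_contra hc
    have : ¬ i < vs.length := by simpa using hc
    simp [adjL, rows, tp, List.getD, this] at h
  | v :: vs, i + 1, j + 1, h => by
    have := adjL_lt G vs i j (by simpa [adjL, rows] using h)
    simpa using this

theorem no_fork {G : SimpleGraph V} (hF : ForkFree G) (a b c d e f h : V)
    (hab : G.Adj a b) (hac : G.Adj a c) (had : G.Adj a d) (haf : G.Adj a f) (hde : G.Adj d e)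
    (hfh : G.Adj f h) (hae : ¬ G.Adj a e) (hah : ¬ G.Adj a h) (hbc : ¬ G.Adj b c)
    (hbd : ¬ G.Adj b d) (hbe : ¬ G.Adj b e) (hbf : ¬ G.Adj b f) (hbh : ¬ G.Adj b h)
    (hcd : ¬ G.Adj c d) (hce : ¬ G.Adj c e) (hcf : ¬ G.Adj c f) (hch : ¬ G.Adj c h)
    (hdf : ¬ G.Adj d f) (hdh : ¬ G.Adj d h) (hef : ¬ G.Adj e f) (heh : ¬ G.Adj e h)
    (nbc : b ≠ c) : False := by
  have n1 : a ≠ b := hab.ne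
  have n2 : a ≠ c := hac.ne
  have n3 : a ≠ d := had.ne
  have n4 : a ≠ f := haf.ne
  have n5 : d ≠ e := hde.ne
  have n6 : f ≠ h := hfh.ne
  have n7 : a ≠ e := by rintro rfl; exact hbe hab.symm
  have n8 : a ≠ h := by rintro rfl; exact hbh hab.symm
  have n9 : b ≠ d := by rintro rfl; exact hbe hde
  have n10 : b ≠ e := by rintro rfl; exact hae hab
  have n11 : b ≠ f := by rintro rfl; exact hbh hfh
  have n12 : b ≠ h := by rintro rfl; exact hah hab
  have n13 : c ≠ d := by rintro rfl; exact hce hde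
  have n14 : c ≠ e := by rintro rfl; exact hae hac
  have n15 : c ≠ f := by rintro rfl; exact hch hfh
  have n16 : c ≠ h := by rintro rfl; exact hah hac
  have n17 : d ≠ f := by rintro rfl; exact hdh hfh
  have n18 : d ≠ h := by rintro rfl; exact hah had
  have n19 : e ≠ f := by rintro rfl; exact hae haf
  have n20 : e ≠ h := by rintro rfl; exact hef hfh.symm
  refine hF.false ⟨⟨![a, b, c, d, e, f, h], ?_⟩, ?_⟩
  · intro i j hij
    fin_cases i <;> fin_cases j <;> simp_all
  · intro i j
    change G.Adj (![a, b, c, d, e, f, h] i) (![a, b, c, d, e, f, h] j) ↔ fork.Adj i j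
    fin_cases i <;> fin_cases j <;>
      simp_all [fork, G.adj_comm]

theorem isFork_false {G : SimpleGraph V} (hF : ForkFree G) (vs : List V) (hn : vs.Nodup)
    (l : List ℕ) : isFork (rows G vs) l = false := by
  by_contra hcon
  have hcon : isFork (rows G vs) l = true := by simpa using hcon
  match l, hcon with
  | [a, b, c, d, e, f, h], hcon =>
    simp only [isFork, Bool.and_eq_true, Bool.not_eq_true', List.all_cons, List.all_nil,
      rows_length, Nat.ble_eq, Nat.succ_le_iff, and_true] at hcon
    obtain ⟨⟨⟨⟨⟨⟨⟨⟨⟨⟨⟨⟨⟨⟨⟨⟨⟨⟨⟨⟨⟨⟨hab, hac⟩, had⟩, haf⟩, hde⟩, hfh⟩, hae⟩, hah⟩, hbc⟩, hbd⟩, hbe⟩, hbf⟩,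
      hbh⟩, hcd⟩, hce⟩, hcf⟩, hch⟩, hdf⟩, hdh⟩, hef⟩, heh⟩, nbc⟩, la, lb, lc, ld, le, lf, lh⟩ := hcon
    have P : ∀ i j (hi : i < vs.length) (hj : j < vs.length), adjL (rows G vs) i j = true →
        G.Adj vs[i] vs[j] := fun i j hi hj => (adjL_iff G vs i j hi hj).1
    have N : ∀ i j (hi : i < vs.length) (hj : j < vs.length), adjL (rows G vs) i j = false →
        ¬ G.Adj vs[i] vs[j] := fun i j hi hj h h' => by
      rw [(adjL_iff G vs i j hi hj).2 h'] at h
      exact absurd h (by simp)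
    refine no_fork hF vs[a] vs[b] vs[c] vs[d] vs[e] vs[f] vs[h] (P _ _ _ _ hab) (P _ _ _ _ hac)
      (P _ _ _ _ had) (P _ _ _ _ haf) (P _ _ _ _ hde) (P _ _ _ _ hfh) (N _ _ _ _ hae)
      (N _ _ _ _ hah) (N _ _ _ _ hbc) (N _ _ _ _ hbd) (N _ _ _ _ hbe) (N _ _ _ _ hbf)
      (N _ _ _ _ hbh) (N _ _ _ _ hcd) (N _ _ _ _ hce) (N _ _ _ _ hcf) (N _ _ _ _ hch)
      (N _ _ _ _ hdf) (N _ _ _ _ hdh) (N _ _ _ _ hef) (N _ _ _ _ heh) ?_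
    intro hvv
    have : b = c := (List.Nodup.getElem_inj_iff hn).1 hvv
    subst this
    simp at nbc

theorem common_false {G : SimpleGraph V} (hT : G.CliqueFree 3) {w v : V} (h : G.Adj w v) :
    ∀ vs : List V, common (tp G w vs) (tp G v vs) = false
  | [] => rfl
  | x :: vs => by
    have ih := common_false hT h vs
    by_cases h1 : G.Adj w x <;> by_cases h2 : G.Adj v x
    · exfalso
      classical
      exact hT {w, v, x} (SimpleGraph.is3Clique_triple_iff.2 ⟨h, h1, h2⟩)
    all_goals simpa [tp, common, h1, h2] using ih

theorem ext_sound {G : SimpleGraph V} (hT : G.CliqueFree 3) (hF : ForkFree G) (vs : List V) (v : V)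
    (hn : (v :: vs).Nodup) (F : List (List ℕ)) (T : List (List Bool))
    (h : ∀ w, w ∉ vs → tp G w vs ∈ T) (w : V) (hw : w ∉ v :: vs) :
    tp G w (v :: vs) ∈ ext (rows G vs) (tp G v vs) F T := by
  rw [ext, List.mem_filter]
  have hw' : w ∉ vs := fun h => hw (List.mem_cons_of_mem _ h)
  constructor
  · rw [List.mem_flatMap]
    refine ⟨tp G w vs, h w hw', ?_⟩
    by_cases hwv : G.Adj w v
    · rw [common_false hT hwv vs]
      simp [tp, hwv]
    · split <;> simp [tp, hwv]
  · have := fun l => isFork_false hF (w :: v :: vs) (List.nodup_cons.2 ⟨hw, hn⟩) l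
    simp only [rows] at this
    simp [this]

theorem hit_iff (G : SimpleGraph V) (k : ℕ) (w : V) (f : V → Option ℕ) : ∀ vs : List V,
    hit k (tp G w vs) (vs.map f) = true ↔ ∃ v ∈ vs, G.Adj w v ∧ f v = some k
  | [] => by simp [tp, hit]
  | x :: vs => by
    classical
    have ih := hit_iff G k w f vs
    have e : tp G w (x :: vs) = decide (G.Adj w x) :: tp G w vs := by
      simp [tp]
    rw [e, List.map_cons]
    by_cases h : G.Adj w x
    · cases hx : f x with
      | none => simp [hit, h, hx, ih]
      | some m => simp [hit, h, hx, ih]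
    · simp [hit, h, ih]

theorem gen_complete (G : SimpleGraph V) (f : V → Option ℕ)
    (hf : ∀ v w k, G.Adj v w → f v = some k → f w ≠ some k) :
    ∀ (vs : List V) (L : List (List (Option ℕ))), List.Forall₂ (fun v l => f v ∈ l) vs L →
      vs.map f ∈ gen (rows G vs) L
  | [], _, _ => by simp [rows, gen]
  | v :: vs, [], h => by cases h
  | v :: vs, a :: L, h => by
    cases h with
    | cons h1 h2 =>
      have ih := gen_complete G f hf vs L h2
      rw [rows, gen, List.mem_flatMap]
      refine ⟨_, ih, ?_⟩
      simp only [List.mem_map, List.mem_filter, List.map_cons]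
      refine ⟨f v, ⟨h1, ?_⟩, rfl⟩
      cases hv : f v with
      | none => rfl
      | some k =>
        simp only [hitO, Bool.not_eq_true']
        by_contra hc
        obtain ⟨x, -, hx, hk⟩ := (hit_iff G k v f vs).1 (by simpa using hc)
        exact hf v x k hx hv hk

theorem gen_sound (G : SimpleGraph V) : ∀ (vs : List V) (L : List (List (Option ℕ)))
    (σ : List (Option ℕ)), vs.Nodup → L.length = vs.length → σ ∈ gen (rows G vs) L →
    ∃ f : V → Option ℕ, List.Forall₂ (fun v l => f v ∈ l) vs L ∧
      ∀ v ∈ vs, ∀ w ∈ vs, ∀ k, G.Adj v w → f v = some k → f w ≠ some k := by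
  suffices H : ∀ (vs : List V) (L : List (List (Option ℕ)))
    (σ : List (Option ℕ)), vs.Nodup → L.length = vs.length → σ ∈ gen (rows G vs) L →
    ∃ f : V → Option ℕ, vs.map f = σ ∧ List.Forall₂ (fun v l => f v ∈ l) vs L ∧
      ∀ v ∈ vs, ∀ w ∈ vs, ∀ k, G.Adj v w → f v = some k → f w ≠ some k by
    intro vs L σ h1 h2 h3
    obtain ⟨f, -, h⟩ := H vs L σ h1 h2 h3
    exact ⟨f, h⟩
  classical
  intro vs
  induction vs with
  | nil =>
    intro L σ _ hL hσ
    have : L = [] := by simpa using hL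
    subst this
    exact ⟨fun _ => none, by simpa [rows, gen, eq_comm] using hσ, .nil, by simp⟩
  | cons v vs ih =>
    intro L σ hn hL hσ
    cases L with
    | nil => simp at hL
    | cons a L =>
      rw [rows, gen, List.mem_flatMap] at hσ
      obtain ⟨c, hc, hσ⟩ := hσ
      obtain ⟨f, rfl, hf1, hf2⟩ := ih L c (List.nodup_cons.1 hn).2 (by simpa using hL) hc
      simp only [List.mem_map, List.mem_filter] at hσ
      obtain ⟨p, ⟨hp, hpc⟩, rfl⟩ := hσ
      have hv : v ∉ vs := (List.nodup_cons.1 hn).1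
      have hupd : ∀ x ∈ vs, Function.update f v p x = f x := by
        intro x hx
        exact Function.update_of_ne (by rintro rfl; exact hv hx) _ _
      have key : ∀ x ∈ vs, ∀ k, G.Adj v x → p = some k → f x ≠ some k := by
        rintro x hx k hvx rfl hfx
        have := (hit_iff G k v f vs).2 ⟨x, hx, hvx, hfx⟩
        simp [hitO, this] at hpc
      refine ⟨Function.update f v p, ?_, ?_, ?_⟩
      · simp only [List.map_cons, Function.update_self, List.cons.injEq, true_and]
        exact List.map_congr_left hupd
      · refine .cons (by simpa using hp) ?_
        refine List.Forall₂.imp ?_ ((List.forall₂_and_left _ _).2 ⟨fun x hx => hx, hf1⟩ :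
          List.Forall₂ (fun x l => x ∈ vs ∧ f x ∈ l) vs L)
        rintro x l ⟨hx, hl⟩
        rwa [hupd x hx]
      · intro x hx y hy k hxy h1 h2
        rcases List.mem_cons.1 hx with rfl | hx
        · rcases List.mem_cons.1 hy with rfl | hy
          · exact hxy.ne rfl
          · rw [hupd y hy] at h2
            exact key y hy k hxy (by simpa using h1) h2
        · rcases List.mem_cons.1 hy with rfl | hy
          · rw [hupd x ‹x ∈ vs›] at h1
            exact key x ‹x ∈ vs› k hxy.symm (by simpa using h2) h1
          · rw [hupd x hx] at h1
            rw [hupd y hy] at h2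
            exact hf2 x hx y hy k hxy h1 h2

theorem orL_length (A z : List Bool) : (orL A z).length = z.length := by
  induction z generalizing A with
  | nil => cases A <;> simp [orL]
  | cons b z ih => cases A <;> simp [orL, ih]

theorem orL_getD (A z : List Bool) (i : ℕ) (hi : i < z.length)
    (h : A.getD i false = true ∨ z.getD i true = true) : (orL A z).getD i true = true := by
  induction z generalizing A i with
  | nil => simp at hi
  | cons b z ih =>
    cases A with
    | nil => simpa [orL] using h
    | cons a A =>
      cases i with
      | zero => simpa [orL] using h
      | succ i => simpa [orL] using ih A i (by simpa using hi) (by simpa using h)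

theorem blocked_length (k : ℕ) (ψ : List (Option ℕ)) (T : List (List Bool)) :
    (blocked k ψ T).length = ψ.length := by
  induction T with
  | nil => simp [blocked]
  | cons A T ih =>
    rw [blocked]
    split
    · exact ih
    · rw [orL_length, ih]

theorem blocked_getD (k : ℕ) (ψ : List (Option ℕ)) (T : List (List Bool)) (A : List Bool)
    (hA : A ∈ T) (hk : hit k A ψ = false) (i : ℕ) (hi : i < ψ.length)
    (hAi : A.getD i false = true) : (blocked k ψ T).getD i true = true := by
  induction T with
  | nil => simp at hA
  | cons B T ih =>
    rw [blocked]
    rcases List.mem_cons.1 hA with rfl | hA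
    · rw [hk]
      exact orL_getD _ _ _ (by rw [blocked_length]; exact hi) (Or.inl hAi)
    · split
      · exact ih hA
      · exact orL_getD _ _ _ (by rw [blocked_length]; exact hi) (Or.inr (ih hA))

theorem allow_length (ψ : List (Option ℕ)) (b0 b1 b2 : List Bool) :
    (allow ψ b0 b1 b2).length = ψ.length := by
  induction ψ generalizing b0 b1 b2 with
  | nil => simp [allow]
  | cons p ψ ih => cases p <;> simp [allow, ih]

theorem allow_getD (ψ : List (Option ℕ)) (b0 b1 b2 : List Bool) (i : ℕ) (hi : i < ψ.length)
    (q : Option ℕ) (hq : q ∈ (allow ψ b0 b1 b2).getD i []) :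
    (∀ k, ψ[i] = some k → q = some k) ∧
    (ψ[i] = none → (q = some 0 ∧ b0.getD i true = false) ∨ (q = some 1 ∧ b1.getD i true = false) ∨
      (q = some 2 ∧ b2.getD i true = false)) := by
  have hd : ∀ b : List Bool, b.headD true = b.getD 0 true := by
    intro b; cases b <;> simp
  have tl : ∀ (b : List Bool) j, b.tail.getD j true = b.getD (j + 1) true := by
    intro b j; cases b <;> simp
  induction ψ generalizing b0 b1 b2 i with
  | nil => simp at hi
  | cons p ψ ih =>
    cases i with
    | zero =>
      cases p with
      | some k =>
        simp only [allow, List.getD_cons_zero, List.mem_singleton] at hq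
        subst hq
        simp
      | none =>
        simp only [allow, List.getD_cons_zero, List.mem_append, hd] at hq
        refine ⟨by simp, fun _ => ?_⟩
        rcases hq with hq | hq | hq
        · left
          split at hq <;> simp_all
        · right; left
          split at hq <;> simp_all
        · right; right
          split at hq <;> simp_all
    | succ i =>
      have hi' : i < ψ.length := by simpa using hi
      have := ih b0.tail b1.tail b2.tail i hi' (by cases p <;> simpa [allow] using hq)
      simpa only [tl, List.getElem_cons_succ] using this

theorem opts_forall (p q : ℕ) (f : V → Option ℕ) (s : V → Bool) : ∀ (vs : List V) (i : ℕ),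
    (∀ v ∈ vs, s v = true → f v = none) →
    (∀ v ∈ vs, s v = false → f v = some 0 ∨ f v = some 1 ∨ f v = some 2) →
    (∀ j (h : j < vs.length), i + j = p → f vs[j] = some 0) →
    (∀ j (h : j < vs.length), i + j = q → f vs[j] = some 1) →
    List.Forall₂ (fun v l => f v ∈ l) vs (opts p q i (vs.map s))
  | [], _, _, _, _, _ => .nil
  | v :: vs, i, h1, h2, h3, h4 => by
    have ih := opts_forall p q f s vs (i + 1)
      (fun v hv => h1 v (List.mem_cons_of_mem _ hv))
      (fun v hv => h2 v (List.mem_cons_of_mem _ hv))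
      (fun j h e => h3 (j + 1) (by simpa using h) (by omega))
      (fun j h e => h4 (j + 1) (by simpa using h) (by omega))
    rw [List.map_cons]
    cases hs : s v with
    | true =>
      rw [opts]
      exact .cons (by simp [h1 v (by simp) hs]) ih
    | false =>
      rw [opts]
      refine .cons ?_ ih
      split
      · rename_i e
        have := h3 0 (by simp) (by simpa using e)
        simpa using this
      · split
        · rename_i e
          have := h4 0 (by simp) (by simpa using e)
          simpa using this
        · simpa using h2 v (by simp) hs

theorem exists_map_eq {α : Type} [Inhabited α] : ∀ (vs : List V) (l : List α), vs.Nodup →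
    l.length = vs.length → ∃ f : V → α, vs.map f = l ∧ ∀ v, v ∉ vs → f v = default := by
  classical
  intro vs
  induction vs with
  | nil =>
    intro l _ h
    exact ⟨fun _ => default, by simpa [eq_comm] using h, fun _ _ => rfl⟩
  | cons v vs ih =>
    intro l hn h
    cases l with
    | nil => simp at h
    | cons a l =>
      obtain ⟨f, hf, hd⟩ := ih l (List.nodup_cons.1 hn).2 (by simpa using h)
      have hv : v ∉ vs := (List.nodup_cons.1 hn).1
      refine ⟨Function.update f v a, ?_, ?_⟩
      · simp only [List.map_cons, Function.update_self, List.cons.injEq, true_and]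
        rw [← hf]
        exact List.map_congr_left fun x hx =>
          Function.update_of_ne (by rintro rfl; exact hv hx) _ _
      · intro x hx
        rw [List.mem_cons, not_or] at hx
        rw [Function.update_of_ne hx.1]
        exact hd x hx.2

theorem bits_length (n m : ℕ) : (bits n m).length = n := by
  induction n generalizing m with
  | zero => rfl
  | succ n ih => simp [bits, ih]

/-- Every proper induced subgraph is 3-colourable. -/
def Crit (G : SimpleGraph V) : Prop :=
  ∀ s : V → Bool, (∃ v, s v = true) → ∃ φ : V → ℕ, (∀ v, φ v < 3) ∧
    ∀ v w, s v = false → s w = false → G.Adj v w → φ v ≠ φ w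

theorem leaf_sound {G : SimpleGraph V} (hC : Crit G) (S : List Bool) (p q : ℕ) (vs : List V)
    (hn : vs.Nodup) (T : List (List Bool)) (hT : ∀ w, w ∉ vs → tp G w vs ∈ T)
    (hS : S.length = vs.length) (h : leafCheck S p q (rows G vs) T = true) :
    ∃ χ : V → ℕ, (∀ v, χ v < 3) ∧ ∀ v w, G.Adj v w → χ v ≠ χ w := by
  classical
  obtain ⟨s, rfl, hs⟩ := exists_map_eq vs S hn hS
  simp only [leafCheck, Bool.and_eq_true, List.all_eq_true, Bool.not_eq_true'] at h
  obtain ⟨⟨⟨⟨hne, hpq⟩, hp⟩, hq⟩, hall⟩ := h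
  obtain ⟨lp, lq⟩ := adjL_lt G vs p q hpq
  have apq := (adjL_iff G vs p q lp lq).1 hpq
  have sp : s vs[p] = false := by simpa [List.getD, lp] using hp
  have sq : s vs[q] = false := by simpa [List.getD, lq] using hq
  obtain ⟨φ0, hφ0, hφ0'⟩ := hC s (by
    obtain ⟨b, hb, hb'⟩ := List.any_eq_true.1 hne
    obtain ⟨v, -, rfl⟩ := List.mem_map.1 hb
    exact ⟨v, hb'⟩)
  obtain ⟨φ, hφ, hφ', p0, q1⟩ : ∃ φ : V → ℕ, (∀ v, φ v < 3) ∧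
      (∀ v w, s v = false → s w = false → G.Adj v w → φ v ≠ φ w) ∧ φ vs[p] = 0 ∧ φ vs[q] = 1 := by
    have hne := hφ0' _ _ sp sq apq
    refine ⟨fun v => if φ0 v = φ0 vs[p] then 0 else if φ0 v = φ0 vs[q] then 1 else 2, ?_, ?_, ?_, ?_⟩
    · intro v
      dsimp only
      split_ifs <;> omega
    · intro v w hv hw hvw
      have h1 := hφ0' v w hv hw hvw
      have h2 := hφ0 v
      have h3 := hφ0 w
      have h4 := hφ0 vs[p]
      have h5 := hφ0 vs[q]
      dsimp only
      split_ifs <;> omega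
    · simp
    · simp [Ne.symm hne]
  let f : V → Option ℕ := fun v => if s v then none else some (φ v)
  have fnone : ∀ v, s v = true → f v = none := fun v h => by simp [f, h]
  have fsome : ∀ v, s v = false → f v = some (φ v) := fun v h => by simp [f, h]
  have fst : ∀ v k, f v = some k → s v = false ∧ φ v = k := by
    intro v k hv
    cases hsv : s v with
    | true => rw [fnone v hsv] at hv; simp at hv
    | false => rw [fsome v hsv] at hv; exact ⟨rfl, by simpa using hv⟩
  have hmem := gen_complete G f (by
    intro v w k hvw h1 h2
    obtain ⟨a1, a2⟩ := fst v k h1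
    obtain ⟨b1, b2⟩ := fst w k h2
    exact hφ' v w a1 b1 hvw (a2.trans b2.symm)) vs _ (opts_forall p q f s vs 0
      (fun v _ => fnone v) (fun v _ hv => by
        rw [fsome v hv]
        have := hφ v
        have : φ v = 0 ∨ φ v = 1 ∨ φ v = 2 := by omega
        simpa using this)
      (fun j hj e => by
        have : j = p := by omega
        subst this
        rw [fsome _ sp, p0])
      (fun j hj e => by
        have : j = q := by omega
        subst this
        rw [fsome _ sq, q1]))
  have hex := hall _ hmem
  rw [forceC_eq, forceB_eq, forceB_eq, forceB_eq] at hex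
  have hex : ∃ σ, σ ∈ gen (rows G vs) (allow (vs.map f) (blocked 0 (vs.map f) T)
      (blocked 1 (vs.map f) T) (blocked 2 (vs.map f) T)) := by
    apply List.exists_mem_of_ne_nil
    intro hnil
    rw [hnil] at hex
    simp at hex
  obtain ⟨σ, hσ⟩ := hex
  obtain ⟨χ, hχ1, hχ2⟩ := gen_sound G vs _ σ hn (by simp [allow_length]) hσ
  rw [List.forall₂_iff_get] at hχ1
  obtain ⟨-, hχ1⟩ := hχ1
  have hidx : ∀ v ∈ vs, (∀ k, f v = some k → χ v = some k) ∧ (f v = none →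
      ∃ k, k < 3 ∧ χ v = some k ∧ ∀ w, w ∉ vs → G.Adj w v → φ w ≠ k) := by
    intro v hv
    obtain ⟨i, hi, rfl⟩ := List.getElem_of_mem hv
    have hl : i < (vs.map f).length := by simpa using hi
    have h1 := hχ1 i hi (by simpa [allow_length] using hi)
    have h2 := allow_getD (vs.map f) (blocked 0 (vs.map f) T)
      (blocked 1 (vs.map f) T) (blocked 2 (vs.map f) T) i hl (χ vs[i]) (by
        rw [List.getD_eq_getElem _ _ (by simpa [allow_length] using hi)]
        simpa using h1)
    rw [List.getElem_map] at h2
    refine ⟨h2.1, fun hf => ?_⟩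
    have main : ∀ k, (blocked k (vs.map f) T).getD i true = false →
        ∀ w, w ∉ vs → G.Adj w vs[i] → φ w ≠ k := by
      intro k hb w hw hadj hk
      have hh : hit k (tp G w vs) (vs.map f) = false := by
        by_contra hc
        obtain ⟨x, hx, hwx, hfx⟩ := (hit_iff G k w f vs).1 (by simpa using hc)
        obtain ⟨a1, a2⟩ := fst x k hfx
        have sw : s w = false := hs w hw
        exact hφ' w x sw a1 hwx (hk.trans a2.symm)
      have := blocked_getD k (vs.map f) T _ (hT w hw) hh i hl ((tp_getD G w vs i hi).2 hadj)
      rw [this] at hb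
      simp at hb
    rcases h2.2 hf with ⟨e, hb⟩ | ⟨e, hb⟩ | ⟨e, hb⟩
    · exact ⟨0, by omega, e, main 0 hb⟩
    · exact ⟨1, by omega, e, main 1 hb⟩
    · exact ⟨2, by omega, e, main 2 hb⟩
  have hval : ∀ v ∈ vs, ∃ k, k < 3 ∧ χ v = some k ∧ ∀ w, w ∉ vs → G.Adj w v → φ w ≠ k := by
    intro v hv
    cases hsv : s v with
    | true => exact (hidx v hv).2 (fnone v hsv)
    | false =>
      exact ⟨φ v, hφ v, (hidx v hv).1 _ (fsome v hsv), fun w hw hwv =>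
        hφ' w v (hs w hw) hsv hwv⟩
  refine ⟨fun v => if v ∈ vs then (χ v).getD 0 else φ v, ?_, ?_⟩
  · intro v
    dsimp only
    split
    · rename_i hv
      obtain ⟨k, hk, e, -⟩ := hval v hv
      simpa [e] using hk
    · exact hφ v
  · intro v w hvw
    dsimp only
    by_cases hv : v ∈ vs <;> by_cases hw : w ∈ vs
    · obtain ⟨k, hk, e, -⟩ := hval v hv
      obtain ⟨k', hk', e', -⟩ := hval w hw
      have := hχ2 v hv w hw k hvw e
      simp only [hv, hw, if_true, e, e', Option.getD_some]
      rintro rfl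
      exact this e'
    · obtain ⟨k, hk, e, h⟩ := hval v hv
      simp only [hv, hw, if_true, if_false, e, Option.getD_some]
      exact (h w hw hvw.symm).symm
    · obtain ⟨k, hk, e, h⟩ := hval w hw
      simp only [hv, hw, if_true, if_false, e, Option.getD_some]
      exact h v hv hvw
    · simp only [hv, hw, if_false]
      exact hφ' v w (hs v hv) (hs w hw) hvw

theorem check_sound {G : SimpleGraph V} (h3 : G.CliqueFree 3) (hF : ForkFree G) (hC : Crit G)
    (hno : ¬ ∃ χ : V → ℕ, (∀ v, χ v < 3) ∧ ∀ v w, G.Adj v w → χ v ≠ χ w) (c : Cert) :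
    ∀ (vs : List V) (T : List (List Bool)), vs.Nodup → (∀ w, w ∉ vs → tp G w vs ∈ T) →
      check c (rows G vs) T = true → False := by
  induction c with
  | leaf S p q =>
    intro vs T hn hT h
    rw [check, forceB_eq] at h
    exact hno (leaf_sound hC _ p q vs hn T hT (by rw [bits_length, rows_length]) h)
  | split A F c₁ c₂ ih₁ ih₂ =>
    intro vs T hn hT h
    rw [check, forceB_eq, forceT_eq, forceT_eq, Bool.and_eq_true] at h
    by_cases hex : ∃ w, w ∉ vs ∧ tp G w vs = bits (rows G vs).length A
    · obtain ⟨w, hw, e⟩ := hex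
      rw [← e] at h
      have hn' : (w :: vs).Nodup := List.nodup_cons.2 ⟨hw, hn⟩
      exact ih₁ (w :: vs) _ hn' (ext_sound h3 hF vs w hn' F T hT) h.1
    · refine ih₂ vs _ hn ?_ h.2
      intro w hw
      rw [List.mem_filter]
      refine ⟨hT w hw, ?_⟩
      rw [Bool.not_eq_true', ← Bool.not_eq_true, eqb_eq]
      exact fun e => hex ⟨w, hw, e⟩

theorem build_sound {G : SimpleGraph V} (h3 : G.CliqueFree 3) (hF : ForkFree G) (hC : Crit G)
    (hno : ¬ ∃ χ : V → ℕ, (∀ v, χ v < 3) ∧ ∀ v w, G.Adj v w → χ v ≠ χ w) (c : Cert) :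
    ∀ (ws : List V) (l : List (ℕ × List (List ℕ))) (vs : List V) (T : List (List Bool)),
      ws.length = l.length → (ws.reverse ++ vs).Nodup → (∀ w, w ∉ vs → tp G w vs ∈ T) →
      (∀ i (hi : i < ws.length) (hl : i < l.length),
        tp G ws[i] ((ws.take i).reverse ++ vs) = bits (i + vs.length) l[i].1) →
      buildCheck c l (rows G vs) T = true → False := by
  intro ws
  induction ws with
  | nil =>
    intro l vs T hl hn hT hr h
    have : l = [] := by simpa [eq_comm] using hl
    subst this
    exact check_sound h3 hF hC hno c vs T (by simpa using hn) hT h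
  | cons w ws ih =>
    intro l vs T hl hn hT hr h
    cases l with
    | nil => simp at hl
    | cons AF l =>
      obtain ⟨A, F⟩ := AF
      rw [buildCheck, forceB_eq, forceT_eq] at h
      have e : tp G w vs = bits (rows G vs).length A := by
        have h0 := hr 0 (by simp) (by simp)
        rw [Nat.zero_add] at h0
        rw [rows_length]
        exact h0
      rw [← e] at h
      have hn1 : (ws.reverse ++ (w :: vs)).Nodup := by simpa using hn
      have hn2 : (w :: vs).Nodup := (List.nodup_append.1 hn1).2.1
      refine ih l (w :: vs) _ (by simpa using hl) hn1 (ext_sound h3 hF vs w hn2 F T hT) ?_ h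
      intro i hi hl
      have := hr (i + 1) (by simpa using hi) (by simpa using hl)
      simpa [Nat.add_assoc, Nat.add_comm 1] using this

end Sound

/-- Base configuration: rows together with the forks used to restrict outside vertices. -/
def rootSteps : List (ℕ × List (List ℕ)) :=
  [(0, []),
   (1, []),
   (1, []),
   (1, []),
   (9, []),
   (20, []),
   (36, []),
   (2, [[6, 7, 0, 5, 4, 3, 1], [8, 7, 2, 4, 0, 3, 1], [5, 4, 2, 6, 7, 0, 1], [8, 4, 2, 7, 0, 3, 1], [8, 7, 4, 3, 1, 2, 0], [8, 7, 0, 4, 5, 3, 1], [8, 4, 2, 7, 6, 0, 1]]),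
   (3, [[4, 9, 0, 7, 6, 2, 1], [3, 9, 0, 6, 7, 1, 2], [6, 5, 0, 7, 8, 3, 1], [9, 8, 4, 5, 0, 3, 1], [9, 5, 4, 8, 0, 3, 1], [4, 7, 0, 9, 5, 2, 1], [3, 6, 0, 9, 8, 1, 2]])]

/-- The case tree. -/
def cert : Cert :=
  .split 134 [[4, 10, 1, 7, 8, 2, 0], [3, 2, 1, 5, 8, 0, 6], [8, 5, 0, 9, 1, 7, 6], [1, 9, 0, 4, 7, 3, 5], [5, 8, 0, 10, 6, 3, 1], [7, 6, 0, 8, 5, 4, 1], [4, 2, 0, 7, 6, 1, 9], [3, 5, 2, 1, 9, 0, 6], [1, 4, 3, 9, 8, 0, 6], [0, 5, 2, 7, 6, 1, 9], [9, 10, 0, 8, 7, 1, 3]]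
  (
   .leaf 32 8 9)
  (
  .split 145 [[4, 7, 0, 10, 5, 2, 1], [2, 3, 0, 4, 7, 1, 9], [1, 6, 0, 9, 8, 2, 4], [2, 4, 0, 3, 5, 1, 9], [6, 7, 0, 10, 5, 1, 2], [8, 5, 0, 9, 1, 7, 4], [2, 1, 0, 4, 7, 3, 5]]
  (
   .split 4 [[6, 9, 0, 11, 5, 4, 1], [10, 9, 2, 11, 5, 0, 1], [4, 1, 0, 6, 11, 3, 2], [8, 7, 5, 9, 10, 0, 1], [0, 9, 2, 5, 11, 4, 1], [0, 9, 2, 11, 5, 4, 1]]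
   (
    .leaf 2016 2 4)
   (
   .split 82 [[11, 10, 7, 6, 1, 5, 0], [8, 7, 5, 9, 10, 1, 0]]
   (
    .split 27 [[7, 10, 0, 12, 8, 5, 1], [3, 4, 1, 8, 12, 0, 10], [6, 9, 4, 12, 11, 1, 0], [11, 12, 0, 10, 9, 3, 1]]
    (
     .leaf 8 10 11)
    (
    .split 283 [[10, 11, 7, 9, 8, 1, 0], [12, 11, 8, 7, 0, 6, 1]]
    (
     .leaf 16 10 11)
    (
    .split 612 [[9, 6, 2, 10, 0, 8, 1], [11, 10, 3, 12, 6, 1, 0]]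
    (
     .leaf 1024 8 9)
    (
    .leaf 1520 2 3))))
   (
   .leaf 20 8 9)))
  (
  .split 146 [[5, 8, 0, 10, 4, 3, 1], [3, 5, 0, 2, 4, 1, 9], [1, 9, 0, 6, 7, 3, 5], [7, 4, 0, 8, 5, 6, 1], [3, 1, 0, 5, 8, 2, 4], [3, 2, 0, 5, 8, 1, 6], [6, 10, 0, 7, 8, 1, 3]]
  (
   .split 2 [[5, 8, 0, 11, 6, 3, 1], [7, 8, 2, 11, 6, 0, 1], [3, 1, 0, 5, 11, 4, 2], [0, 8, 2, 6, 11, 3, 1], [9, 8, 6, 10, 2, 0, 1], [0, 8, 2, 11, 6, 3, 1]]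
   (
    .leaf 2000 3 5)
   (
   .split 140 [[11, 10, 7, 6, 0, 5, 1], [9, 8, 6, 10, 2, 1, 0]]
   (
    .split 39 [[6, 9, 0, 12, 11, 4, 1], [3, 5, 1, 11, 12, 0, 9], [7, 10, 5, 12, 8, 1, 0], [8, 12, 0, 9, 10, 3, 1]]
    (
     .leaf 16 10 11)
    (
    .split 167 [[9, 8, 6, 10, 11, 1, 0], [12, 11, 8, 7, 1, 6, 0]]
    (
     .leaf 8 10 11)
    (
    .split 600 [[10, 7, 2, 11, 1, 9, 0], [11, 12, 3, 10, 9, 1, 0]]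
    (
     .leaf 128 10 11)
    (
    .leaf 1968 2 3))))
   (
   .leaf 10 8 9)))
  (
  .split 144 [[4, 7, 2, 10, 5, 0, 1], [5, 8, 3, 10, 4, 0, 1], [6, 10, 1, 7, 8, 0, 3], [6, 10, 1, 7, 8, 0, 2], [7, 4, 0, 8, 5, 6, 1], [8, 5, 0, 9, 1, 7, 4], [9, 10, 1, 8, 7, 0, 2], [0, 10, 1, 7, 8, 2, 3], [0, 10, 1, 8, 7, 3, 2]]
  (
   .split 3 [[3, 4, 0, 5, 11, 1, 2], [2, 10, 0, 7, 8, 1, 3], [5, 8, 0, 11, 10, 3, 1], [0, 9, 4, 5, 11, 1, 2], [3, 1, 0, 5, 8, 4, 6], [7, 8, 0, 11, 6, 2, 1]]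
   (
    .leaf 1968 2 3)
   (
   .split 5 [[4, 3, 0, 6, 11, 1, 2], [6, 9, 0, 11, 7, 4, 1], [2, 7, 0, 10, 9, 1, 4], [0, 8, 3, 6, 11, 1, 2], [4, 1, 0, 6, 9, 3, 5], [7, 8, 0, 11, 6, 2, 1]]
   (
    .leaf 1968 2 3)
   (
   .split 67 [[3, 4, 0, 5, 11, 1, 2], [8, 7, 5, 9, 10, 1, 0], [0, 9, 4, 5, 11, 1, 2], [1, 2, 0, 8, 9, 3, 4], [2, 7, 0, 10, 9, 1, 3], [8, 7, 1, 9, 10, 5, 0], [10, 9, 0, 11, 5, 2, 1]]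
   (
    .split 266 [[5, 1, 0, 7, 12, 4, 2], [10, 11, 7, 9, 8, 1, 0], [5, 4, 0, 7, 12, 1, 3], [9, 2, 0, 10, 1, 8, 12]]
    (
     .leaf 2144 9 10)
    (
    .leaf 2035 2 3))
   (
   .split 133 [[4, 3, 0, 6, 11, 1, 2], [9, 10, 6, 8, 7, 1, 0], [0, 8, 3, 6, 11, 1, 2], [1, 2, 0, 9, 8, 4, 3], [2, 10, 0, 7, 8, 1, 4], [9, 10, 1, 8, 7, 6, 0], [7, 8, 0, 11, 6, 2, 1]]
   (
    .leaf 1234 8 9)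
   (
   .split 1 [[5, 8, 3, 11, 10, 0, 1], [6, 9, 4, 11, 7, 0, 1], [7, 8, 0, 11, 6, 2, 1], [10, 9, 0, 11, 5, 2, 1]]
   (
    .split 164 [[9, 8, 6, 10, 11, 1, 0], [7, 10, 1, 12, 8, 5, 0], [7, 10, 5, 12, 6, 1, 0], [4, 5, 1, 6, 12, 0, 2], [12, 11, 8, 7, 1, 6, 0], [7, 5, 0, 12, 11, 1, 9]]
    (
     .leaf 16 10 11)
    (
    .split 280 [[10, 11, 7, 9, 8, 1, 0], [6, 9, 1, 12, 11, 4, 0], [6, 9, 4, 12, 7, 1, 0], [5, 4, 1, 7, 12, 0, 2], [6, 4, 0, 12, 8, 1, 10]]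
    (
     .leaf 8 10 11)
    (
    .split 24 [[6, 9, 4, 12, 7, 1, 0], [6, 9, 1, 12, 11, 4, 0], [5, 4, 1, 7, 12, 0, 2]]
    (
     .leaf 8 10 11)
    (
    .leaf 1968 2 3))))
   (
   .leaf 1 8 9))))))
  (
  .split 150 [[4, 10, 1, 7, 8, 2, 0], [1, 9, 0, 6, 7, 3, 5], [3, 2, 0, 5, 8, 1, 6]]
  (
   .leaf 32 8 9)
  (
  .leaf 128 5 6)))))

set_option maxRecDepth 100000 in
theorem cert_ok : buildCheck cert rootSteps [] [[]] = true := by decide +kernel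

section Main

variable {V : Type}

theorem notAdj_of_common {G : SimpleGraph V} (hT : G.CliqueFree 3) {x y z : V} (h1 : G.Adj x y)
    (h2 : G.Adj x z) : ¬ G.Adj y z := by
  classical
  intro h3
  exact hT {x, y, z} (SimpleGraph.is3Clique_triple_iff.2 ⟨h1, h2, h3⟩)

theorem core {G : SimpleGraph V} (h3 : G.CliqueFree 3) (hF : ForkFree G) (hC : Crit G)
    (hno : ¬ ∃ χ : V → ℕ, (∀ v, χ v < 3) ∧ ∀ v w, G.Adj v w → χ v ≠ χ w)
    (a c1 c2 c3 c4 x1 x2 u1 u2 : V)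
    (h01 : G.Adj a c1) (h12 : G.Adj c1 c2) (h23 : G.Adj c2 c3) (h34 : G.Adj c3 c4)
    (h40 : G.Adj c4 a) (hx1 : G.Adj x1 a) (hx1c : G.Adj x1 c2) (hx1u : G.Adj x1 u1)
    (hx2 : G.Adj x2 a) (hx2c : G.Adj x2 c3) (hx2u : G.Adj x2 u2) (hu : G.Adj u1 u2)
    (n10 : ¬ G.Adj u1 a) (n11 : ¬ G.Adj u1 c1) (n12 : ¬ G.Adj u1 c2) (n13 : ¬ G.Adj u1 c3)
    (n14 : ¬ G.Adj u1 c4) (n20 : ¬ G.Adj u2 a) (n21 : ¬ G.Adj u2 c1) (n22 : ¬ G.Adj u2 c2)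
    (n23 : ¬ G.Adj u2 c3) (n24 : ¬ G.Adj u2 c4) : False := by
  have m1 : ¬ G.Adj c2 a := notAdj_of_common h3 h12 h01.symm
  have m2 : ¬ G.Adj c3 a := notAdj_of_common h3 h34.symm.symm.symm h40
  have m3 : ¬ G.Adj c3 c1 := notAdj_of_common h3 h23 h12.symm
  have m4 : ¬ G.Adj c4 c1 := notAdj_of_common h3 h40.symm h01
  have m5 : ¬ G.Adj c4 c2 := notAdj_of_common h3 h34 h23.symm
  have m6 : ¬ G.Adj x1 c1 := notAdj_of_common h3 hx1.symm h01
  have m7 : ¬ G.Adj x1 c4 := notAdj_of_common h3 hx1.symm h40.symm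
  have m8 : ¬ G.Adj x1 c3 := notAdj_of_common h3 hx1c.symm h23
  have m9 : ¬ G.Adj x2 c1 := notAdj_of_common h3 hx2.symm h01
  have m10 : ¬ G.Adj x2 c4 := notAdj_of_common h3 hx2.symm h40.symm
  have m11 : ¬ G.Adj x2 c2 := notAdj_of_common h3 hx2c.symm h23.symm
  have m12 : ¬ G.Adj x2 x1 := notAdj_of_common h3 hx2.symm hx1.symm
  have m13 : ¬ G.Adj u1 x2 := notAdj_of_common h3 hu.symm hx2u.symm
  have m14 : ¬ G.Adj u2 x1 := notAdj_of_common h3 hu hx1u.symm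
  refine build_sound h3 hF hC hno cert [a, c1, c2, c3, c4, x1, x2, u1, u2] rootSteps [] [[]] rfl
    ?_ (by simp [tp]) ?_ cert_ok
  · simp only [List.reverse_cons, List.reverse_nil, List.nil_append, List.append_nil,
      List.cons_append, List.nodup_cons, List.mem_cons, List.not_mem_nil, or_false, not_or,
      List.nodup_nil, and_true, not_false_eq_true]
    have e1 := h01.ne
    have e2 := h12.ne
    have e3 := h23.ne
    have e4 := h34.ne
    have e5 := h40.ne
    and_intros <;> (intro h; subst h; grind [SimpleGraph.adj_comm])
  · intro i hi hl
    simp only [List.length_cons, List.length_nil] at hi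
    have hi' : i < 9 := by omega
    interval_cases i <;>
      simp [tp, rootSteps, bits, *, h01.symm, h12.symm, h23.symm, h34.symm, hx1u.symm, hx2u.symm,
        hu.symm] <;> rfl

theorem crit_of_minCex [Fintype V] {G : SimpleGraph V} (hG : MinCex G) : Crit G := by
  classical
  intro s ⟨v, hv⟩
  obtain ⟨h3, hF, -, hmin⟩ := hG
  have hcol := hmin {w : V // s w = false} (G.comap Subtype.val)
    (Fintype.card_subtype_lt (x := v) (by simp [hv]))
    (h3.comap ⟨(SimpleGraph.Embedding.comap (Function.Embedding.subtype _) G).toCopy⟩)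
    ⟨fun e => hF.false ((SimpleGraph.Embedding.comap (Function.Embedding.subtype _) G).comp e)⟩
  rw [← Nat.cast_three, SimpleGraph.chromaticNumber_le_iff_colorable] at hcol
  obtain ⟨C⟩ := hcol
  refine ⟨fun w => if h : s w = false then (C ⟨w, h⟩ : ℕ) else 0, ?_, ?_⟩
  · intro w
    dsimp only
    split
    · exact (C _).2
    · omega
  · intro x y hx hy hxy
    simp only [hx, hy, dif_pos]
    intro he
    exact C.valid (v := ⟨x, hx⟩) (w := ⟨y, hy⟩) (by simpa using hxy) (Fin.ext he)

theorem no_col_of_minCex [Fintype V] {G : SimpleGraph V} (hG : MinCex G) :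
    ¬ ∃ χ : V → ℕ, (∀ v, χ v < 3) ∧ ∀ v w, G.Adj v w → χ v ≠ χ w := by
  rintro ⟨χ, h1, h2⟩
  have hc : G.Colorable 3 := ⟨SimpleGraph.Coloring.mk (fun v => (⟨χ v, h1 v⟩ : Fin 3)) (by
    intro v w hvw he
    exact h2 v w hvw (by simpa using he))⟩
  have h4 := hG.2.2.1.trans hc.chromaticNumber_le
  exact absurd h4 (by decide)

theorem exists_mid {G : SimpleGraph V} {u v : V} (h : G.dist u v = 2) :
    ∃ x, G.Adj u x ∧ G.Adj x v := by
  have hr : G.Reachable u v := by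
    by_contra hc
    rw [SimpleGraph.dist_eq_zero_of_not_reachable hc] at h
    omega
  obtain ⟨p, hp⟩ := hr.exists_walk_length_eq_dist
  rw [h] at hp
  match p, hp with
  | .cons h1 (.cons h2 .nil), _ => exact ⟨_, h1, h2⟩

end Main

end ForkProof

theorem minCex_adjacent_second_nbhd_no_common_c_vertex {V : Type} [Fintype V]
    (G : SimpleGraph V) (hG : MinCex G) (c : Fin 5 → V) (hc : IsC5 G c)
    (u1 u2 : V) (hne : u1 ≠ u2)
    (h1 : distC G c u1 = 2) (h2 : distC G c u2 = 2) (hadj : G.Adj u1 u2) :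
    ¬ ∃ i : Fin 5, G.dist u1 (c i) = 2 ∧ G.dist u2 (c i) = 2 := by
  rintro ⟨i, hi1, hi2⟩
  obtain ⟨h3, hF, -, -⟩ := id hG
  have hC := ForkProof.crit_of_minCex hG
  have hno := ForkProof.no_col_of_minCex hG
  obtain ⟨-, hcyc⟩ := hc
  have far : ∀ u, distC G c u = 2 → ∀ j, ¬ G.Adj u (c j) := by
    intro u hu j hadj
    have h1 : distC G c u ≤ G.dist u (c j) := Finset.inf'_le _ (Finset.mem_univ j)
    rw [SimpleGraph.dist_eq_one_iff_adj.2 hadj] at h1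
    omega
  have f1 := far u1 h1
  have f2 := far u2 h2
  obtain ⟨x1, hux1, hx1⟩ := ForkProof.exists_mid hi1
  obtain ⟨x2, hux2, hx2⟩ := ForkProof.exists_mid hi2
  have e01 := hcyc i
  have e12 := hcyc (i + 1)
  have e23 := hcyc (i + 1 + 1)
  have e34 := hcyc (i + 1 + 1 + 1)
  have e40 := hcyc (i + 1 + 1 + 1 + 1)
  have hi5 : i + 1 + 1 + 1 + 1 + 1 = i := by omega
  rw [hi5] at e40
  have g1 := f1 i
  have g2 := f2 i
  have g11 := f1 (i + 1)
  have g21 := f2 (i + 1)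
  have g12 := f1 (i + 1 + 1)
  have g22 := f2 (i + 1 + 1)
  have g13 := f1 (i + 1 + 1 + 1)
  have g23 := f2 (i + 1 + 1 + 1)
  have g14 := f1 (i + 1 + 1 + 1 + 1)
  have g24 := f2 (i + 1 + 1 + 1 + 1)
  generalize c (i + 1 + 1 + 1 + 1) = c4 at *
  generalize c (i + 1 + 1 + 1) = c3 at *
  generalize c (i + 1 + 1) = c2 at *
  generalize c (i + 1) = c1 at *
  generalize c i = a at *
  have nc := @ForkProof.notAdj_of_common V G h3
  have mx : ¬ G.Adj x1 x2 := nc hx1.symm hx2.symm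
  have m1 : ¬ G.Adj u1 x2 := nc hadj.symm hux2
  have m2 : ¬ G.Adj u2 x1 := nc hadj hux1
  have nx : x1 ≠ x2 := by rintro rfl; exact m1 hux1
  have s : ∀ {x y}, ¬ G.Adj x y → ¬ G.Adj y x := fun h h' => h h'.symm
  have key2 : G.Adj x1 c2 ∨ G.Adj x2 c2 := by
    by_contra hcon
    rw [not_or] at hcon
    exact ForkProof.no_fork hF a c4 x2 x1 u1 c1 c2 e40.symm hx2.symm hx1.symm e01 hux1.symm e12
      (s g1) (nc e01.symm e12) (nc e40.symm hx2.symm) (nc e40.symm hx1.symm) (s g14)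
      (nc e40.symm e01) (nc e34 e23.symm) (nc hx2.symm hx1.symm) (s m1) (nc hx2.symm e01) hcon.2
      (nc hx1.symm e01) hcon.1 g11 g12 (by rintro rfl; exact g24 hux2)
  have key3 : G.Adj x1 c3 ∨ G.Adj x2 c3 := by
    by_contra hcon
    rw [not_or] at hcon
    exact ForkProof.no_fork hF a c1 x2 x1 u1 c4 c3 e01 hx2.symm hx1.symm e40.symm hux1.symm e34.symm
      (s g1) (nc e40 e34.symm) (nc e01 hx2.symm) (nc e01 hx1.symm) (s g11)
      (nc e01 e40.symm) (nc e12.symm e23) (nc hx2.symm hx1.symm) (s m1) (nc hx2.symm e40.symm) hcon.2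
      (nc hx1.symm e40.symm) hcon.1 g14 g13 (by rintro rfl; exact g21 hux2)
  rcases key2 with k2 | k2 <;> rcases key3 with k3 | k3
  · exact nc k2 k3 e23
  · exact ForkProof.core h3 hF hC hno a c1 c2 c3 c4 x1 x2 u1 u2 e01 e12 e23 e34 e40 hx1 k2
      hux1.symm hx2 k3 hux2.symm hadj g1 g11 g12 g13 g14 g2 g21 g22 g23 g24
  · exact ForkProof.core h3 hF hC hno a c1 c2 c3 c4 x2 x1 u2 u1 e01 e12 e23 e34 e40 hx2 k2
      hux2.symm hx1 k3 hux1.symm hadj.symm g2 g21 g22 g23 g24 g1 g11 g12 g13 g14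
  · exact nc k2 k3 e23
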